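/- Let m : (0,∞) → ℝ be any function, and let φ₁, φ₂ : ℝ → ℝ be integrable functions with φ₁ ≥ 0, ∫_ℝ φ₂ ≠ 0, and such that x₁ ↦ |x₁|·φ₁(x₁) and x₁ ↦ |x₁|·φ₂(x₁) are integrable on ℝ. Then there exists a constant C > 0 (depending only on φ₁, φ₂ and N) such that for every t > 0 and every f ∈ H¹_{loc}(Ω) with f·φ₂(·+m(t)) ∈ L¹(Ω) and ∇f ∈ L²(Ω): ∫_Ω f(x)²·φ₁(x₁ + m(t)) dx ≤ C·[ (∫_Ω f(x)·φ₂(x₁ + m(t)) dx)² + ∫_Ω |∇f(x)|² dx ]. -/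

import Mathlib

open MeasureTheory Filter Topology

noncomputable section

namespace ShockMultiD

/-- Spatial domain representative: `ℝ × ℝ^{N-1}`; functions on `Ω = ℝ × 𝕋^{N-1}` are
represented by functions on this space that are `1`-periodic in the transverse variables. -/
abbrev Spc (N : ℕ) := ℝ × (Fin (N - 1) → ℝ)

variable (N : ℕ)

/-- Fundamental cell of the torus `𝕋^{N-1}`. -/
def cell : Set (Fin (N - 1) → ℝ) := Set.univ.pi fun _ => Set.Ico (0 : ℝ) 1

/-- Integration region representing `Ω = ℝ × 𝕋^{N-1}`. -/
def ΩQ : Set (Spc N) := Set.univ ×ˢ cell N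

/-- 1-periodicity in the transverse variables. -/
def PeriodicTr (f : Spc N → ℝ) : Prop :=
  ∀ (x : Spc N) (p : Fin (N - 1) → ℤ), f (x.1, x.2 + fun i => (p i : ℝ)) = f x

/-- partial derivative in the normal direction `x₁` -/
def pd1 (f : Spc N → ℝ) (x : Spc N) : ℝ := deriv (fun y => f (y, x.2)) x.1

/-- partial derivative in the `i`-th transverse direction -/
def pdt (i : Fin (N - 1)) (f : Spc N → ℝ) (x : Spc N) : ℝ :=
  deriv (fun y => f (x.1, Function.update x.2 i y)) (x.2 i)

/-- `|∇f|²` -/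
def gradSq (f : Spc N → ℝ) (x : Spc N) : ℝ :=
  pd1 N f x ^ 2 + ∑ i, pdt N i f x ^ 2

/-- Laplacian `Δf` -/
def lap (f : Spc N → ℝ) (x : Spc N) : ℝ :=
  pd1 N (pd1 N f) x + ∑ i, pdt N i (pdt N i f) x

/-- time derivative `∂ₜ f` -/
def pdT (f : ℝ → Spc N → ℝ) (t : ℝ) (x : Spc N) : ℝ := deriv (fun s => f s x) t

/-- iterated partial derivatives: `none` = normal direction, `some i` = transverse -/
def pdList : List (Option (Fin (N - 1))) → (Spc N → ℝ) → Spc N → ℝ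
  | [], f => f
  | none :: l, f => pd1 N (pdList l f)
  | some i :: l, f => pdt N i (pdList l f)

/-- Squared `H^s` norm of `f`, all integrals taken over `S`. -/
def HsNormSqOn (s : ℕ) (S : Set (Spc N)) (f : Spc N → ℝ) : ℝ :=
  ∑ k ∈ Finset.range (s + 1),
    ∑ α : Fin k → Option (Fin (N - 1)),
      ∫ x in S, (pdList N (List.ofFn α) f x) ^ 2

/-- Squared `H^s(Ω)` norm. -/
def HsNormSq (s : ℕ) (f : Spc N → ℝ) : ℝ := HsNormSqOn N s (ΩQ N) f

/-- Squared `H^s` norm of the full gradient `∇f` over `S`. -/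
def gradHsSqOn (s : ℕ) (S : Set (Spc N)) (f : Spc N → ℝ) : ℝ :=
  HsNormSqOn N s S (pd1 N f) + ∑ i, HsNormSqOn N s S (pdt N i f)

/-- Local window `[a,a+1] × 𝕋^{N-1}` used for (uniformly) local Sobolev norms. -/
def ΩWin (a : ℝ) : Set (Spc N) := Set.Icc a (a + 1) ×ˢ cell N

/-- Flux data: `A = (A₁, A₂, …, A_N)`, smooth, `A₁` strictly convex. -/
structure Flux where
  A1 : ℝ → ℝ
  Atr : Fin (N - 1) → ℝ → ℝ
  smooth1 : ContDiff ℝ (⊤ : ℕ∞) A1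
  smoothtr : ∀ i, ContDiff ℝ (⊤ : ℕ∞) (Atr i)
  convex1 : ∀ v : ℝ, 0 < deriv (deriv A1) v

/-- Relative flux `A₁(a|b)`. -/
def relF1 (F : Flux N) (a b : ℝ) : ℝ := F.A1 a - F.A1 b - deriv F.A1 b * (a - b)

/-- Relative flux, transverse components. -/
def relFt (F : Flux N) (i : Fin (N - 1)) (a b : ℝ) : ℝ :=
  F.Atr i a - F.Atr i b - deriv (F.Atr i) b * (a - b)

/-- Stationary planar viscous shock profile connecting `um` (at `-∞`) to `up` (at `+∞`). -/
structure IsShockProfile (A1 : ℝ → ℝ) (U : ℝ → ℝ) (up um : ℝ) : Prop where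
  smooth : ContDiff ℝ (⊤ : ℕ∞) U
  profileEq : ∀ x : ℝ, deriv (fun y => A1 (U y)) x = deriv (deriv U) x
  tendPlus : Filter.Tendsto U Filter.atTop (nhds up)
  tendMinus : Filter.Tendsto U Filter.atBot (nhds um)
  endLt : up < um
  rh : A1 up = A1 um
  laxPlus : deriv A1 up < 0
  laxMinus : 0 < deriv A1 um

/-- (transversally periodic) classical solution of `∂ₜ u + div A(u) = Δu` on `(0,∞) × Ω`. -/
def SolvesCL (F : Flux N) (u : ℝ → Spc N → ℝ) : Prop :=
  (∀ t : ℝ, PeriodicTr N (u t)) ∧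
  ∀ t : ℝ, 0 < t → ∀ x : Spc N,
    pdT N u t x + (pd1 N (fun y => F.A1 (u t y)) x
      + ∑ i, pdt N i (fun y => F.Atr i (u t y)) x) = lap N (u t) x

/-- temporal cutoff `φ`: `φ = 0` on `(0, t₀/2)`, `φ = 1` on `(t₀, ∞)`. -/
def IsCutoffPhi (t₀ : ℝ) (φ : ℝ → ℝ) : Prop :=
  ContDiff ℝ (⊤ : ℕ∞) φ ∧ (∀ t, φ t ∈ Set.Icc (0:ℝ) 1) ∧
    (∀ t ∈ Set.Ioo 0 (t₀ / 2), φ t = 0) ∧ ∀ t, t₀ < t → φ t = 1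

/-- spatial cutoff `ψ_M`: `ψ_M = 1` on `[-M,M]`, `ψ_M = 0` outside `[-(M+1), M+1]`. -/
def IsCutoffPsi (M : ℝ) (ψ : ℝ → ℝ) : Prop :=
  ContDiff ℝ (⊤ : ℕ∞) ψ ∧ (∀ y, ψ y ∈ Set.Icc (0:ℝ) 1) ∧
    (∀ y ∈ Set.Icc (-M) M, ψ y = 1) ∧ ∀ y : ℝ, M + 1 < |y| → ψ y = 0

/-- first component of `w = φ(t)·A(u | U(Y+x₁))/(u - U(Y+x₁))` -/
def wrel1 (F : Flux N) (U : ℝ → ℝ) (φ : ℝ → ℝ) (u Y : ℝ → Spc N → ℝ)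
    (t : ℝ) (x : Spc N) : ℝ :=
  φ t * relF1 N F (u t x) (U (Y t x + x.1)) / (u t x - U (Y t x + x.1))

/-- transverse components of `w` -/
def wrelT (F : Flux N) (U : ℝ → ℝ) (φ : ℝ → ℝ) (u Y : ℝ → Spc N → ℝ)
    (i : Fin (N - 1)) (t : ℝ) (x : Spc N) : ℝ :=
  φ t * relFt N F i (u t x) (U (Y t x + x.1)) / (u t x - U (Y t x + x.1))

/-- `h_M(t)`, the average of `w₁` over `{|x₁+m(t)| ≤ M+1} × 𝕋^{N-1}` -/
def hMfun (F : Flux N) (U : ℝ → ℝ) (φ : ℝ → ℝ) (u Y : ℝ → Spc N → ℝ)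
    (m : ℝ → ℝ) (M : ℝ) (t : ℝ) : ℝ :=
  (1 / (2 * (M + 1))) *
    ∫ x in {x : Spc N | |x.1 + m t| ≤ M + 1} ∩ ΩQ N, wrel1 N F U φ u Y t x

/-- `g(t) = ∫_Ω (u - U(Y+x₁)) U'(x₁+m(t)) dx` -/
def gfun (U : ℝ → ℝ) (u Y : ℝ → Spc N → ℝ) (m : ℝ → ℝ) (t : ℝ) : ℝ :=
  ∫ x in ΩQ N, (u t x - U (Y t x + x.1)) * deriv U (x.1 + m t)

/-- `m(t)·∫_Ω |U'(x₁+m(t))| dx = ∫_Ω |U'(x₁+m(t))| Y dx` for `t ∈ I`. -/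
def mImplicit (U : ℝ → ℝ) (Y : ℝ → Spc N → ℝ) (m : ℝ → ℝ) (I : Set ℝ) : Prop :=
  ∀ t ∈ I, m t * ∫ x in ΩQ N, |deriv U (x.1 + m t)| =
    ∫ x in ΩQ N, |deriv U (x.1 + m t)| * Y t x

/-- `Y` solves the shift equation (with temporal weight `φ`) on the time set `I`,
with `Y(0,·) = 0` and `m` the associated spatially homogeneous shift. -/
def SolvesShiftEq (F : Flux N) (U : ℝ → ℝ) (φ ψ : ℝ → ℝ) (M : ℝ)
    (u Y : ℝ → Spc N → ℝ) (m : ℝ → ℝ) (I : Set ℝ) : Prop :=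
  (∀ x, Y 0 x = 0) ∧ (∀ t ∈ I, PeriodicTr N (Y t)) ∧ mImplicit N U Y m I ∧
  ∀ t ∈ I, ∀ x : Spc N,
    pdT N Y t x
      - deriv F.A1 (U (Y t x + x.1)) * pd1 N (Y t) x
      + (∑ i, deriv (F.Atr i) (U (Y t x + x.1)) * pdt N i (Y t) x)
      - deriv F.A1 (U (Y t x + x.1)) * gradSq N (Y t) x
      + (wrel1 N F U φ u Y t x * pd1 N (Y t) x
          + ∑ i, wrelT N F U φ u Y i t x * pdt N i (Y t) x)
      - lap N (Y t) x
    = -((wrel1 N F U φ u Y t x - hMfun N F U φ u Y m M t) * ψ (x.1 + m t))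
        - hMfun N F U φ u Y m M t - gfun N U u Y m t

/-- the homogeneous parabolic shift equation (special perturbations, Theorem 1.2) -/
def SolvesFreeShiftEq (F : Flux N) (U : ℝ → ℝ) (Y : ℝ → Spc N → ℝ) : Prop :=
  ∀ t : ℝ, 0 < t → ∀ x : Spc N,
    pdT N Y t x
      - deriv F.A1 (U (Y t x + x.1)) * pd1 N (Y t) x
      + (∑ i, deriv (F.Atr i) (U (Y t x + x.1)) * pdt N i (Y t) x)
      - deriv F.A1 (U (Y t x + x.1)) * gradSq N (Y t) x
      - lap N (Y t) x = 0

end ShockMultiD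

namespace ShockMultiD

open scoped ENNReal

lemma sq_lintegral_le {α : Type*} [MeasurableSpace α] (μ : Measure α) {h : α → ℝ≥0∞}
    (hh : AEMeasurable h μ) :
    (∫⁻ x, h x ∂μ) ^ 2 ≤ μ Set.univ * ∫⁻ x, h x ^ 2 ∂μ := by
  have key := ENNReal.lintegral_mul_le_Lp_mul_Lq μ Real.HolderConjugate.two_two
    (aemeasurable_const (b := (1 : ℝ≥0∞))) hh
  simp only [Pi.mul_apply, one_mul, ENNReal.rpow_two, one_pow, lintegral_one] at key
  calc (∫⁻ x, h x ∂μ) ^ 2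
      ≤ (μ Set.univ ^ (1 / 2 : ℝ) * (∫⁻ x, h x ^ 2 ∂μ) ^ (1 / 2 : ℝ)) ^ 2 := by gcongr
    _ = μ Set.univ * ∫⁻ x, h x ^ 2 ∂μ := by
      rw [mul_pow, ← ENNReal.rpow_two, ← ENNReal.rpow_two, ← ENNReal.rpow_mul,
        ← ENNReal.rpow_mul]
      norm_num

lemma enorm_sub_le_lintegral_deriv {g g' : ℝ → ℝ} (hg : ∀ x, HasDerivAt g (g' x) x)
    (a b : ℝ) : ‖g b - g a‖ₑ ≤ ∫⁻ s in Set.uIoc a b, ‖g' s‖ₑ := by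
  by_cases hfin : ∫⁻ s in Set.uIoc a b, ‖g' s‖ₑ = ⊤
  · simp [hfin]
  have hmeas : Measurable g' := by
    rw [show g' = deriv g from funext fun x => (hg x).deriv.symm]
    exact measurable_deriv g
  have hint : IntervalIntegrable g' volume a b := by
    rw [intervalIntegrable_iff]
    exact ⟨hmeas.aestronglyMeasurable, by
      rw [hasFiniteIntegral_iff_enorm]; exact lt_top_iff_ne_top.mpr hfin⟩
  rw [← intervalIntegral.integral_eq_sub_of_hasDerivAt (fun x _ => hg x) hint]
  calc ‖∫ s in a..b, g' s‖ₑ = ‖∫ s in Set.uIoc a b, g' s‖ₑ := by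
        rw [← ofReal_norm, intervalIntegral.norm_integral_eq_norm_integral_uIoc, ofReal_norm]
    _ ≤ _ := enorm_integral_le_lintegral_enorm _

lemma enorm_sub_sq_le_lintegral_deriv_sq {g g' : ℝ → ℝ} (hg : ∀ x, HasDerivAt g (g' x) x)
    (a b : ℝ) :
    ‖g b - g a‖ₑ ^ 2 ≤ ‖b - a‖ₑ * ∫⁻ s in Set.uIoc a b, ‖g' s‖ₑ ^ 2 := by
  have hmeas : Measurable g' := by
    rw [show g' = deriv g from funext fun x => (hg x).deriv.symm]
    exact measurable_deriv g
  calc ‖g b - g a‖ₑ ^ 2 ≤ (∫⁻ s in Set.uIoc a b, ‖g' s‖ₑ) ^ 2 := by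
        gcongr; exact enorm_sub_le_lintegral_deriv hg a b
    _ ≤ _ := sq_lintegral_le _ hmeas.enorm.aemeasurable
    _ = _ := by
      simp [Set.uIoc, Real.volume_Ioc, max_sub_min_eq_abs, ← ofReal_norm, abs_sub_comm]

section Segment

variable {E : Type*} [NormedAddCommGroup E] [NormedSpace ℝ E] [FiniteDimensional ℝ E]
  [MeasurableSpace E] [BorelSpace E] (μ : Measure E) [μ.IsAddHaarMeasure]

lemma setLIntegral_comp_homothety_le {K : Set E} (hK : Convex ℝ K) (hKm : MeasurableSet K)
    {H : E → ℝ≥0∞} (hH : Measurable H) {w : E} (hw : w ∈ K) {r : ℝ} (hr : 1 / 2 ≤ r)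
    (hr1 : r ≤ 1) :
    ∫⁻ x in K, H ((1 - r) • w + r • x) ∂μ
      ≤ 2 ^ Module.finrank ℝ E * ∫⁻ x in K, H x ∂μ := by
  have hr0 : 0 < r := by linarith
  set F := K.indicator H with hF
  have hFm : Measurable F := hH.indicator hKm
  rw [← lintegral_indicator hKm, ← lintegral_indicator hKm]
  calc ∫⁻ x, K.indicator (fun x => H ((1 - r) • w + r • x)) x ∂μ
      ≤ ∫⁻ x, F ((1 - r) • w + r • x) ∂μ := by
        refine lintegral_mono fun x => ?_
        by_cases hx : x ∈ K
        · have : (1 - r) • w + r • x ∈ K := hK hw hx (by linarith) hr0.le (by ring)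
          simp [hF, hx, this]
        · simp [hx]
    _ = ∫⁻ y, F ((1 - r) • w + y) ∂(Measure.map (fun x => r • x) μ) := by
        rw [lintegral_map (f := fun y => F ((1 - r) • w + y))
          (hFm.comp (measurable_const_add _)) (measurable_const_smul r)]
    _ = ENNReal.ofReal |(r ^ Module.finrank ℝ E)⁻¹| * ∫⁻ y, F y ∂μ := by
        rw [Measure.map_addHaar_smul μ hr0.ne', lintegral_smul_measure, smul_eq_mul,
          lintegral_add_left_eq_self]
    _ ≤ _ := by
        gcongr
        rw [abs_of_pos (by positivity), ← inv_pow,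
          ENNReal.ofReal_pow (by positivity)]
        gcongr
        rw [← ENNReal.ofReal_ofNat]
        apply ENNReal.ofReal_le_ofReal
        rw [inv_le_comm₀ hr0 (by norm_num)]
        linarith

lemma lintegral_lintegral_sub_sq_le {K : Set E} (hK : Convex ℝ K) (hKm : MeasurableSet K)
    {R : ℝ≥0∞} (hR : ∀ x ∈ K, ∀ y ∈ K, ‖x - y‖ₑ ≤ R) {f : E → ℝ} (hf : Differentiable ℝ f) :
    ∫⁻ x in K, ∫⁻ y in K, ‖f y - f x‖ₑ ^ 2 ∂μ ∂μ
      ≤ R ^ 2 * (2 ^ Module.finrank ℝ E * μ K * ∫⁻ x in K, ‖fderiv ℝ f x‖ₑ ^ 2 ∂μ) := by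
  have : SecondCountableTopology E := by
    have := FiniteDimensional.proper_real E
    exact secondCountable_of_proper
  set H : E → ℝ≥0∞ := fun x => ‖fderiv ℝ f x‖ₑ ^ 2 with hHdef
  have hH : Measurable H := (measurable_fderiv ℝ f).enorm.pow_const 2
  have hpt : ∀ x ∈ K, ∀ y ∈ K, ‖f y - f x‖ₑ ^ 2
      ≤ R ^ 2 * ∫⁻ s in Set.Ioc (0 : ℝ) 1, H ((1 - s) • x + s • y) := by
    intro x hx y hy
    have hd : ∀ s : ℝ, HasDerivAt (fun s : ℝ => f ((1 - s) • x + s • y))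
        (fderiv ℝ f ((1 - s) • x + s • y) (y - x)) s := by
      intro s
      have h1 : HasDerivAt (fun s : ℝ => (1 - s) • x + s • y) (y - x) s := by
        simpa [neg_add_eq_sub] using (((hasDerivAt_id' s).const_sub 1).smul_const x).fun_add
          ((hasDerivAt_id' s).smul_const y)
      exact (hf _).hasFDerivAt.comp_hasDerivAt s h1
    have := enorm_sub_sq_le_lintegral_deriv_sq hd 0 1
    simp only [sub_self, zero_smul, one_smul, zero_add, sub_zero, add_zero, enorm_one,
      one_mul, Set.uIoc_of_le zero_le_one] at this
    refine this.trans ?_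
    have hsm : Measurable fun s : ℝ => H ((1 - s) • x + s • y) := hH.comp (by fun_prop)
    rw [← lintegral_const_mul _ hsm]
    refine lintegral_mono fun s => ?_
    rw [mul_comm, hHdef, ← mul_pow]
    gcongr
    exact (ContinuousLinearMap.le_opENorm _ _).trans (by gcongr; exact hR y hy x hx)
  have hjm : Measurable fun p : ℝ × E × E => H ((1 - p.1) • p.2.1 + p.1 • p.2.2) :=
    hH.comp (by fun_prop)
  have hs : ∀ s ∈ Set.Ioc (0 : ℝ) 1,
      ∫⁻ x in K, ∫⁻ y in K, H ((1 - s) • x + s • y) ∂μ ∂μ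
        ≤ 2 ^ Module.finrank ℝ E * μ K * ∫⁻ x in K, H x ∂μ := by
    intro s hs
    rcases le_total (1 / 2) s with h | h
    · calc _ ≤ ∫⁻ x in K, 2 ^ Module.finrank ℝ E * ∫⁻ x in K, H x ∂μ ∂μ :=
            setLIntegral_mono' hKm fun x hx =>
              setLIntegral_comp_homothety_le μ hK hKm hH hx h hs.2
        _ = _ := by rw [setLIntegral_const]; ring
    · rw [lintegral_lintegral_swap (f := fun x y => H ((1 - s) • x + s • y))
        (hH.comp (by fun_prop : Measurable fun z : E × E =>
          (1 - s) • z.1 + s • z.2)).aemeasurable]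
      calc _ ≤ ∫⁻ x in K, 2 ^ Module.finrank ℝ E * ∫⁻ x in K, H x ∂μ ∂μ := by
            refine setLIntegral_mono' hKm fun y hy => ?_
            have := setLIntegral_comp_homothety_le μ hK hKm hH hy
              (r := 1 - s) (by linarith) (by linarith [hs.1])
            simpa only [sub_sub_cancel, add_comm] using this
        _ = _ := by rw [setLIntegral_const]; ring
  calc ∫⁻ x in K, ∫⁻ y in K, ‖f y - f x‖ₑ ^ 2 ∂μ ∂μ
      ≤ ∫⁻ x in K, ∫⁻ y in K, (R ^ 2 * ∫⁻ s in Set.Ioc (0 : ℝ) 1,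
          H ((1 - s) • x + s • y)) ∂μ ∂μ :=
        setLIntegral_mono' hKm fun x hx => setLIntegral_mono' hKm fun y hy => hpt x hx y hy
    _ = ∫⁻ z, (R ^ 2 * ∫⁻ s in Set.Ioc (0 : ℝ) 1, H ((1 - s) • z.1 + s • z.2))
          ∂((μ.restrict K).prod (μ.restrict K)) := by
        rw [lintegral_prod]
        exact (Measurable.const_mul (Measurable.lintegral_prod_left' hjm) _).aemeasurable
    _ = R ^ 2 * ∫⁻ s in Set.Ioc (0 : ℝ) 1, ∫⁻ z, H ((1 - s) • z.1 + s • z.2)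
          ∂((μ.restrict K).prod (μ.restrict K)) := by
        rw [lintegral_const_mul _ (Measurable.lintegral_prod_left' hjm),
          lintegral_lintegral_swap]
        exact (hjm.comp measurable_swap).aemeasurable
    _ ≤ R ^ 2 * ∫⁻ s in Set.Ioc (0 : ℝ) 1,
          2 ^ Module.finrank ℝ E * μ K * ∫⁻ x in K, H x ∂μ := by
        refine mul_le_mul' le_rfl (setLIntegral_mono' measurableSet_Ioc fun s hs' => ?_)
        have hsm : Measurable fun z : E × E => H ((1 - s) • z.1 + s • z.2) :=
          hH.comp (by fun_prop)
        rw [lintegral_prod _ hsm.aemeasurable]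
        exact hs s hs'
    _ = _ := by simp

end Segment

variable (N : ℕ)

lemma measurableSet_cell : MeasurableSet (cell N) :=
  MeasurableSet.univ_pi fun _ => measurableSet_Ico

lemma convex_cell : Convex ℝ (cell N) := convex_pi fun _ _ => convex_Ico 0 1

lemma volume_cell : volume (cell N) = 1 := by
  simp [cell, volume_pi_pi]

instance : IsProbabilityMeasure (volume.restrict (cell N)) :=
  ⟨by simp [volume_cell]⟩

lemma volume_restrict_prod_cell (s : Set ℝ) :
    (volume : Measure (Spc N)).restrict (s ×ˢ cell N)
      = (volume.restrict s).prod (volume.restrict (cell N)) := by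
  rw [Measure.prod_restrict, Measure.volume_eq_prod]

lemma volume_restrict_ΩQ :
    (volume : Measure (Spc N)).restrict (ΩQ N)
      = (volume : Measure ℝ).prod (volume.restrict (cell N)) := by
  rw [ΩQ, volume_restrict_prod_cell, Measure.restrict_univ]

lemma measurePreserving_fst_add (a : ℝ) :
    MeasurePreserving (fun x : Spc N => x.1 + a) (volume.restrict (ΩQ N)) volume := by
  rw [volume_restrict_ΩQ]
  exact (measurePreserving_add_right volume a).comp measurePreserving_fst

lemma enorm_sub_le_one_of_mem {a : ℝ} {x y : Spc N} (hx : x ∈ Set.Icc (-a) (1 - a) ×ˢ cell N)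
    (hy : y ∈ Set.Icc (-a) (1 - a) ×ˢ cell N) : ‖x - y‖ₑ ≤ 1 := by
  obtain ⟨⟨hx1, hx2⟩, hx3⟩ := hx
  obtain ⟨⟨hy1, hy2⟩, hy3⟩ := hy
  rw [← ofReal_norm, ENNReal.ofReal_le_one, Prod.norm_def, max_le_iff,
    pi_norm_le_iff_of_nonneg zero_le_one]
  refine ⟨?_, fun i => ?_⟩
  · rw [Real.norm_eq_abs, abs_le, Prod.fst_sub]
    constructor <;> linarith
  · have h1 := hx3 i (Set.mem_univ i)
    have h2 := hy3 i (Set.mem_univ i)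
    rw [Real.norm_eq_abs, abs_le, Prod.snd_sub, Pi.sub_apply]
    constructor <;> linarith [h1.1, h1.2, h2.1, h2.2]

lemma enorm_sq_le_two_mul (u v : ℝ) : ‖u + v‖ₑ ^ 2 ≤ 2 * ‖u‖ₑ ^ 2 + 2 * ‖v‖ₑ ^ 2 := by
  have h (r : ℝ) : ‖r‖ₑ ^ 2 = ENNReal.ofReal (r ^ 2) := by
    rw [← ofReal_norm, ← ENNReal.ofReal_pow (norm_nonneg r), Real.norm_eq_abs, sq_abs]
  rw [h, h, h, ← mul_add, ← ENNReal.ofReal_add (sq_nonneg u) (sq_nonneg v),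
    ← ENNReal.ofReal_ofNat, ← ENNReal.ofReal_mul zero_le_two]
  exact ENNReal.ofReal_le_ofReal (by nlinarith [sq_nonneg (u - v)])

variable {N}

lemma enorm_sub_sq_le_of_snd_eq {f : Spc N → ℝ} (hf : Differentiable ℝ f) (r s : ℝ)
    (z : Fin (N - 1) → ℝ) :
    ‖f (r, z) - f (s, z)‖ₑ ^ 2 ≤ ‖r - s‖ₑ * ∫⁻ q : ℝ, ‖fderiv ℝ f (q, z)‖ₑ ^ 2 := by
  have hd (q : ℝ) : HasDerivAt (fun q : ℝ => f (q, z)) (fderiv ℝ f (q, z) (1, 0)) q :=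
    (hf _).hasFDerivAt.comp_hasDerivAt q ((hasDerivAt_id' q).prodMk (hasDerivAt_const q z))
  refine (enorm_sub_sq_le_lintegral_deriv_sq hd s r).trans ?_
  refine mul_le_mul' le_rfl ((setLIntegral_le_lintegral _ _).trans (lintegral_mono fun q => ?_))
  gcongr
  refine (ContinuousLinearMap.le_opENorm _ _).trans_eq ?_
  simp [← ofReal_norm, Prod.norm_def]

lemma exists_lintegral_sub_sq_mul_le (a : ℝ) {ψ : ℝ → ℝ≥0∞} (hψ : AEMeasurable ψ)
    {f : Spc N → ℝ} (hf : Differentiable ℝ f) :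
    ∃ c : ℝ, ∫⁻ x in ΩQ N, ‖f x - c‖ₑ ^ 2 * ψ (x.1 + a)
      ≤ (2 * (∫⁻ y, ψ y * (‖y‖ₑ + 1)) + 2 * (∫⁻ y, ψ y) * 2 ^ Module.finrank ℝ (Spc N))
        * ∫⁻ x in ΩQ N, ‖fderiv ℝ f x‖ₑ ^ 2 := by
  set H : Spc N → ℝ≥0∞ := fun x => ‖fderiv ℝ f x‖ₑ ^ 2
  have hH : Measurable H := (measurable_fderiv ℝ f).enorm.pow_const 2
  have hfm : Measurable f := hf.continuous.measurable
  set I := Set.Icc (-a) (1 - a) with hI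
  set K : Set (Spc N) := I ×ˢ cell N with hK
  have hIvol : volume I = 1 := by simp [hI]
  have hKm : MeasurableSet K := measurableSet_Icc.prod (measurableSet_cell N)
  have hKvol : volume K = 1 := by
    rw [hK, Measure.volume_eq_prod, Measure.prod_prod, hIvol, volume_cell, one_mul]
  have : IsProbabilityMeasure ((volume : Measure (Spc N)).restrict K) := ⟨by simp [hKvol]⟩
  have : (volume : Measure (Spc N)).IsAddHaarMeasure := by
    rw [Measure.volume_eq_prod]; infer_instance
  have hcube := lintegral_lintegral_sub_sq_le volume ((convex_Icc _ _).prod (convex_cell N)) hKm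
    (fun x hx y hy => enorm_sub_le_one_of_mem N hx hy) hf
  obtain ⟨x₀, hx₀⟩ := exists_le_lintegral (μ := (volume : Measure (Spc N)).restrict K)
    (f := fun x => ∫⁻ y in K, ‖f y - f x‖ₑ ^ 2)
    (Measurable.lintegral_prod_right' (f := fun p : Spc N × Spc N => ‖f p.2 - f p.1‖ₑ ^ 2)
      (by fun_prop)).aemeasurable
  set c := f x₀
  have hc : ∫⁻ y in K, ‖f y - c‖ₑ ^ 2
      ≤ 2 ^ Module.finrank ℝ (Spc N) * ∫⁻ x in ΩQ N, H x := by
    refine (hx₀.trans hcube).trans ?_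
    rw [hKvol, one_pow, one_mul, mul_one]
    gcongr
    exact Set.prod_mono (Set.subset_univ _) subset_rfl
  set ν := (volume : Measure (Fin (N - 1) → ℝ)).restrict (cell N)
  set G : (Fin (N - 1) → ℝ) → ℝ≥0∞ := fun z => ∫⁻ q : ℝ, H (q, z)
  set D : (Fin (N - 1) → ℝ) → ℝ≥0∞ := fun z => ∫⁻ s in I, ‖f (s, z) - c‖ₑ ^ 2
  have hGm : Measurable G := Measurable.lintegral_prod_left' hH
  have hDm : Measurable D :=
    Measurable.lintegral_prod_left' (f := fun p : Spc N => ‖f p - c‖ₑ ^ 2) (by fun_prop)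
  have hG : ∫⁻ z, G z ∂ν = ∫⁻ x in ΩQ N, H x := by
    rw [volume_restrict_ΩQ, lintegral_prod_symm _ hH.aemeasurable]
  have hD : ∫⁻ z, D z ∂ν = ∫⁻ y in K, ‖f y - c‖ₑ ^ 2 := by
    rw [hK, volume_restrict_prod_cell, lintegral_prod_symm _ (by fun_prop)]
  have hpt (x : Spc N) : ‖f x - c‖ₑ ^ 2 ≤ 2 * ((‖x.1 + a‖ₑ + 1) * G x.2) + 2 * D x.2 := by
    have hprob : IsProbabilityMeasure ((volume : Measure ℝ).restrict I) := ⟨by simp [hIvol]⟩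
    calc ‖f x - c‖ₑ ^ 2 = ∫⁻ _ in I, ‖f x - c‖ₑ ^ 2 := by simp
      _ ≤ ∫⁻ s in I, (2 * ((‖x.1 + a‖ₑ + 1) * G x.2) + 2 * ‖f (s, x.2) - c‖ₑ ^ 2) := by
        refine setLIntegral_mono' measurableSet_Icc fun s hs => ?_
        have h1 := enorm_sq_le_two_mul (f (x.1, x.2) - f (s, x.2)) (f (s, x.2) - c)
        rw [sub_add_sub_cancel] at h1
        refine h1.trans ?_
        gcongr
        refine (enorm_sub_sq_le_of_snd_eq hf x.1 s x.2).trans (mul_le_mul' ?_ le_rfl)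
        calc ‖x.1 - s‖ₑ = ‖(x.1 + a) - (s + a)‖ₑ := by ring_nf
          _ ≤ ‖x.1 + a‖ₑ + ‖s + a‖ₑ := enorm_sub_le
          _ ≤ _ := by
            gcongr
            rw [← ofReal_norm, ENNReal.ofReal_le_one, Real.norm_eq_abs, abs_le]
            constructor <;> linarith [hs.1, hs.2]
      _ = _ := by
        rw [lintegral_add_left measurable_const,
          lintegral_const_mul 2 (f := fun s => ‖f (s, x.2) - c‖ₑ ^ 2) (by fun_prop)]
        simp [D]
  refine ⟨c, ?_⟩
  have hψa : AEMeasurable (fun y : ℝ => ψ (y + a)) :=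
    hψ.comp_quasiMeasurePreserving
      (measurePreserving_add_right volume a).quasiMeasurePreserving
  calc ∫⁻ x in ΩQ N, ‖f x - c‖ₑ ^ 2 * ψ (x.1 + a)
      ≤ ∫⁻ x in ΩQ N, (2 * ((ψ (x.1 + a) * (‖x.1 + a‖ₑ + 1)) * G x.2)
          + 2 * (ψ (x.1 + a) * D x.2)) := by
        refine lintegral_mono fun x => (mul_le_mul' (hpt x) le_rfl).trans_eq ?_
        ring
    _ = 2 * ((∫⁻ y, ψ (y + a) * (‖y + a‖ₑ + 1)) * ∫⁻ z, G z ∂ν)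
          + 2 * ((∫⁻ y, ψ (y + a)) * ∫⁻ z, D z ∂ν) := by
        have hw : AEMeasurable fun y : ℝ => ψ (y + a) * (‖y + a‖ₑ + 1) :=
          hψa.mul (by fun_prop)
        rw [volume_restrict_ΩQ, lintegral_add_left', lintegral_const_mul'',
          lintegral_const_mul'', lintegral_prod_mul hw hGm.aemeasurable,
          lintegral_prod_mul hψa hDm.aemeasurable]
        · exact hψa.comp_fst.mul hDm.aemeasurable.comp_snd
        · exact hw.comp_fst.mul hGm.aemeasurable.comp_snd
        · exact (hw.comp_fst.mul hGm.aemeasurable.comp_snd).const_mul 2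
    _ ≤ _ := by
        rw [lintegral_add_right_eq_self ψ a,
          lintegral_add_right_eq_self (fun y => ψ y * (‖y‖ₑ + 1)) a, hG, hD, add_mul]
        gcongr ?_ + ?_
        · rw [mul_assoc]
        · rw [mul_assoc 2, mul_assoc 2, mul_assoc (∫⁻ y, ψ y)]
          gcongr

lemma pd1_eq_fderiv {f : Spc N → ℝ} (hf : Differentiable ℝ f) (x : Spc N) :
    pd1 N f x = fderiv ℝ f x (1, 0) :=
  HasDerivAt.deriv <| (hf _).hasFDerivAt.comp_hasDerivAt x.1
    ((hasDerivAt_id' x.1).prodMk (hasDerivAt_const x.1 x.2))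

lemma pdt_eq_fderiv {f : Spc N → ℝ} (hf : Differentiable ℝ f) (i : Fin (N - 1)) (x : Spc N) :
    pdt N i f x = fderiv ℝ f x (0, Pi.single i 1) := by
  have h := (hf (x.1, Function.update x.2 i (x.2 i))).hasFDerivAt.comp_hasDerivAt (x.2 i)
    ((hasDerivAt_const (x.2 i) x.1).prodMk (hasDerivAt_update x.2 i (x.2 i)))
  simpa [pdt, Function.comp_def] using h.deriv

lemma norm_fderiv_sq_le_gradSq {f : Spc N → ℝ} (hf : Differentiable ℝ f) (x : Spc N) :
    ‖fderiv ℝ f x‖ ^ 2 ≤ 2 * ((N - 1 : ℕ) + 1) * gradSq N f x := by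
  set p := pd1 N f x
  set q : Fin (N - 1) → ℝ := fun i => pdt N i f x
  have hnorm : ‖fderiv ℝ f x‖ ≤ |p| + ∑ i, |q i| := by
    refine ContinuousLinearMap.opNorm_le_bound _ (by positivity) fun v => ?_
    have hv : v = v.1 • ((1 : ℝ), (0 : Fin (N - 1) → ℝ))
        + ∑ i, v.2 i • ((0 : ℝ), (Pi.single i 1 : Fin (N - 1) → ℝ)) := by
      ext j
      · simp [Prod.fst_sum]
      · simp [Prod.snd_sum, Finset.sum_apply, Pi.single_apply]
    have hL : fderiv ℝ f x v = v.1 * p + ∑ i, v.2 i * q i := by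
      conv_lhs => rw [hv]
      simp only [map_add, map_sum, map_smul, smul_eq_mul, p, q, pd1_eq_fderiv hf,
        pdt_eq_fderiv hf]
    rw [hL, Real.norm_eq_abs, add_mul, Finset.sum_mul]
    refine (abs_add_le _ _).trans (add_le_add ?_ ((Finset.abs_sum_le_sum_abs _ _).trans
      (Finset.sum_le_sum fun i _ => ?_)))
    · rw [abs_mul, mul_comm]
      gcongr
      exact norm_fst_le v
    · rw [abs_mul, mul_comm]
      gcongr
      exact (norm_le_pi_norm v.2 i).trans (norm_snd_le v)
  have hsum : (∑ i, |q i|) ^ 2 ≤ (N - 1 : ℕ) * ∑ i, q i ^ 2 := by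
    simpa using sq_sum_le_card_mul_sum_sq (s := Finset.univ) (f := fun i => |q i|)
  have hq : 0 ≤ ∑ i, q i ^ 2 := Finset.sum_nonneg fun i _ => sq_nonneg _
  have hn : (0 : ℝ) ≤ (N - 1 : ℕ) := Nat.cast_nonneg _
  calc ‖fderiv ℝ f x‖ ^ 2 ≤ (|p| + ∑ i, |q i|) ^ 2 := by gcongr
    _ ≤ 2 * |p| ^ 2 + 2 * (∑ i, |q i|) ^ 2 := by
      nlinarith [sq_nonneg (|p| - ∑ i, |q i|)]
    _ ≤ 2 * ((N - 1 : ℕ) + 1) * (p ^ 2 + ∑ i, q i ^ 2) := by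
      rw [sq_abs]
      nlinarith [mul_nonneg hn (sq_nonneg p)]

lemma gradSq_nonneg (f : Spc N → ℝ) (x : Spc N) : 0 ≤ gradSq N f x :=
  add_nonneg (sq_nonneg _) (Finset.sum_nonneg fun _ _ => sq_nonneg _)

variable (N) in
/-- A weighted Poincaré inequality with an unspecified centring constant, the multiplicative
constant being uniform in the translate `a` of the weight. -/
lemma exists_forall_exists_integral_sub_sq_mul_le {ψ : ℝ → ℝ} (hψ : Integrable ψ)
    (hψ0 : ∀ y, 0 ≤ ψ y) (hψx : Integrable fun y => |y| * ψ y) :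
    ∃ B : ℝ, 0 ≤ B ∧ ∀ (a : ℝ) (f : Spc N → ℝ), Differentiable ℝ f →
      IntegrableOn (fun x => gradSq N f x) (ΩQ N) →
      ∃ c : ℝ, IntegrableOn (fun x : Spc N => (f x - c) ^ 2 * ψ (x.1 + a)) (ΩQ N) ∧
        ∫ x in ΩQ N, (f x - c) ^ 2 * ψ (x.1 + a) ≤ B * ∫ x in ΩQ N, gradSq N f x := by
  set w : ℝ → ℝ≥0∞ := fun y => ENNReal.ofReal (ψ y)
  have hw : AEMeasurable w := hψ.aestronglyMeasurable.aemeasurable.ennreal_ofReal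
  have hK0 : ∫⁻ y, w y ≠ ⊤ := hψ.lintegral_lt_top.ne
  have hK1 : ∫⁻ y, w y * (‖y‖ₑ + 1) ≠ ⊤ := by
    have h := (hψx.add hψ).lintegral_lt_top.ne
    convert h using 4 with y
    rw [Pi.add_apply, ← add_one_mul, mul_comm, ENNReal.ofReal_mul (by positivity),
      ENNReal.ofReal_add (abs_nonneg y) zero_le_one, ENNReal.ofReal_one, ← Real.norm_eq_abs,
      ofReal_norm]
  set M : ℝ≥0∞ :=
    2 * (∫⁻ y, w y * (‖y‖ₑ + 1)) + 2 * (∫⁻ y, w y) * 2 ^ Module.finrank ℝ (Spc N)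
  have hMtop : M ≠ ⊤ := by finiteness
  set κ : ℝ := 2 * ((N - 1 : ℕ) + 1)
  have hκ : 0 ≤ κ := by positivity
  refine ⟨M.toReal * κ, by positivity, fun a f hf hgrad => ?_⟩
  obtain ⟨c, hc⟩ := exists_lintegral_sub_sq_mul_le a hw hf
  have hnn (x : Spc N) : 0 ≤ (f x - c) ^ 2 * ψ (x.1 + a) := mul_nonneg (sq_nonneg _) (hψ0 _)
  set J := ∫ x in ΩQ N, gradSq N f x
  have hH : ∫⁻ x in ΩQ N, ‖fderiv ℝ f x‖ₑ ^ 2 ≤ ENNReal.ofReal (κ * J) := by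
    rw [← integral_const_mul, ofReal_integral_eq_lintegral_ofReal (hgrad.const_mul κ)
      (ae_of_all _ fun x => mul_nonneg hκ (gradSq_nonneg f x))]
    refine lintegral_mono fun x => ?_
    rw [← ofReal_norm, ← ENNReal.ofReal_pow (norm_nonneg _)]
    exact ENNReal.ofReal_le_ofReal (norm_fderiv_sq_le_gradSq hf x)
  have hle : ∫⁻ x in ΩQ N, ENNReal.ofReal ((f x - c) ^ 2 * ψ (x.1 + a))
      ≤ ENNReal.ofReal (M.toReal * κ * J) := by
    rw [mul_assoc, ENNReal.ofReal_mul ENNReal.toReal_nonneg, ENNReal.ofReal_toReal hMtop]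
    refine le_trans (le_of_eq ?_) (hc.trans (mul_le_mul' le_rfl hH))
    refine lintegral_congr fun x => ?_
    rw [ENNReal.ofReal_mul (sq_nonneg _), ← sq_abs, ENNReal.ofReal_pow (abs_nonneg _),
      ← Real.norm_eq_abs, ofReal_norm]
  have hmeas : AEStronglyMeasurable (fun x : Spc N => (f x - c) ^ 2 * ψ (x.1 + a))
      (volume.restrict (ΩQ N)) :=
    ((hf.continuous.sub continuous_const).pow 2).aestronglyMeasurable.mul
      (((measurePreserving_fst_add N a).integrable_comp_of_integrable hψ).aestronglyMeasurable)
  refine ⟨c, ⟨hmeas, ?_⟩, ?_⟩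
  · rw [hasFiniteIntegral_iff_ofReal (ae_of_all _ hnn)]
    exact hle.trans_lt ENNReal.ofReal_lt_top
  · rw [integral_eq_lintegral_of_nonneg_ae (ae_of_all _ hnn) hmeas]
    refine ENNReal.toReal_le_of_le_ofReal ?_ hle
    exact mul_nonneg (by positivity) (integral_nonneg fun x => gradSq_nonneg f x)

/-- Lemma 2.2 (weighted Poincaré-type inequality on `Ω = ℝ × 𝕋^{N-1}`). -/
theorem weighted_poincare
    (N : ℕ) (hN : 2 ≤ N) (m : ℝ → ℝ) (φ₁ φ₂ : ℝ → ℝ)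
    (hφ₁int : Integrable φ₁) (hφ₂int : Integrable φ₂)
    (hφ₁pos : ∀ y : ℝ, 0 ≤ φ₁ y)
    (hφ₂ne : (∫ y : ℝ, φ₂ y) ≠ 0)
    (hφ₁x : Integrable (fun y : ℝ => |y| * φ₁ y))
    (hφ₂x : Integrable (fun y : ℝ => |y| * φ₂ y)) :
    ∃ C > (0:ℝ), ∀ t : ℝ, 0 < t → ∀ f : Spc N → ℝ,
      Differentiable ℝ f →
      IntegrableOn (fun x : Spc N => f x * φ₂ (x.1 + m t)) (ΩQ N) →
      IntegrableOn (fun x : Spc N => gradSq N f x) (ΩQ N) →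
      (∫ x in ΩQ N, f x ^ 2 * φ₁ (x.1 + m t))
        ≤ C * ((∫ x in ΩQ N, f x * φ₂ (x.1 + m t)) ^ 2
            + ∫ x in ΩQ N, gradSq N f x) := by
  set ψ : ℝ → ℝ := fun y => φ₁ y + |φ₂ y|
  have hψint : Integrable ψ := hφ₁int.add hφ₂int.abs
  have hψx : Integrable fun y => |y| * ψ y := by
    refine (hφ₁x.add hφ₂x.abs).congr (ae_of_all _ fun y => ?_)
    simp [ψ, mul_add, abs_mul]
  have hψ0 (y : ℝ) : 0 ≤ ψ y := add_nonneg (hφ₁pos y) (abs_nonneg _)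
  obtain ⟨B, hB, hpoinc⟩ := exists_forall_exists_integral_sub_sq_mul_le N hψint hψ0 hψx
  set α := ∫ y, φ₂ y
  set L := ∫ y, ψ y
  set I₁ := ∫ y, φ₁ y
  have hL : 0 ≤ L := integral_nonneg hψ0
  have hI₁ : 0 ≤ I₁ := integral_nonneg hφ₁pos
  have hα : 0 < α ^ 2 := by positivity
  refine ⟨2 * B + 4 * I₁ / α ^ 2 * (B * L + 1) + 1, by positivity, fun t _ f hf hfφ₂ hgrad => ?_⟩
  obtain ⟨c, hint, hle⟩ := hpoinc (m t) f hf hgrad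
  have hmp := measurePreserving_fst_add N (m t)
  have hcomp {φ : ℝ → ℝ} (hφ : Integrable φ) :
      IntegrableOn (fun x : Spc N => φ (x.1 + m t)) (ΩQ N) :=
    hmp.integrable_comp_of_integrable hφ
  have hcompInt {φ : ℝ → ℝ} (hφ : Integrable φ) :
      ∫ x in ΩQ N, φ (x.1 + m t) = ∫ y, φ y := by
    rw [← hmp.map_eq, integral_map hmp.aemeasurable]
    rw [hmp.map_eq]
    exact hφ.aestronglyMeasurable
  set A := ∫ x in ΩQ N, f x * φ₂ (x.1 + m t)
  set G := ∫ x in ΩQ N, gradSq N f x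
  set J := ∫ x in ΩQ N, (f x - c) ^ 2 * ψ (x.1 + m t)
  have hG : 0 ≤ G := integral_nonneg fun x => gradSq_nonneg f x
  have hdiff : IntegrableOn (fun x : Spc N => (f x - c) * φ₂ (x.1 + m t)) (ΩQ N) :=
    (hfφ₂.sub ((hcomp hφ₂int).const_mul c)).congr (ae_of_all _ fun x => by simp [sub_mul])
  have hD : ∫ x in ΩQ N, (f x - c) * φ₂ (x.1 + m t) = A - c * α := by
    simp only [sub_mul]
    rw [integral_sub hfφ₂ ((hcomp hφ₂int).const_mul c), integral_const_mul, hcompInt hφ₂int]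
  have hD2 : (A - c * α) ^ 2 ≤ J * L := by
    have hquad (s : ℝ) : 0 ≤ J * (s * s) + (-2 * (A - c * α)) * s + L := by
      have h : ∫ x in ΩQ N, 2 * s * ((f x - c) * φ₂ (x.1 + m t))
          ≤ ∫ x in ΩQ N, (s ^ 2 * ((f x - c) ^ 2 * ψ (x.1 + m t)) + ψ (x.1 + m t)) := by
        refine integral_mono (hdiff.const_mul _) ((hint.const_mul _).add (hcomp hψint))
          fun x => ?_
        have h1 : |φ₂ (x.1 + m t)| ≤ ψ (x.1 + m t) := le_add_of_nonneg_left (hφ₁pos _)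
        have h2 : 2 * (s * (f x - c)) * φ₂ (x.1 + m t)
            ≤ ((s * (f x - c)) ^ 2 + 1) * |φ₂ (x.1 + m t)| := by
          refine (le_abs_self _).trans ?_
          rw [abs_mul]
          gcongr
          rw [abs_le]
          constructor <;> nlinarith [sq_nonneg (s * (f x - c) + 1), sq_nonneg (s * (f x - c) - 1)]
        have h3 := mul_le_mul_of_nonneg_left h1
          (by positivity : 0 ≤ (s * (f x - c)) ^ 2 + 1)
        simp only
        linarith
      rw [integral_const_mul, hD, integral_add (hint.const_mul _) (hcomp hψint),
        integral_const_mul, hcompInt hψint] at h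
      linarith
    have := discrim_le_zero hquad
    rw [discrim] at this
    linarith
  have hc2 : c ^ 2 * α ^ 2 ≤ 2 * A ^ 2 + 2 * (J * L) := by
    nlinarith [sq_nonneg (A + (A - c * α))]
  have hJL : J * L ≤ B * G * L := by gcongr
  have hc2' : c ^ 2 ≤ 2 * (A ^ 2 + B * G * L) / α ^ 2 := by
    rw [le_div_iff₀ hα]; linarith
  have hmain : ∫ x in ΩQ N, f x ^ 2 * φ₁ (x.1 + m t) ≤ 2 * J + 2 * c ^ 2 * I₁ := by
    have h : ∫ x in ΩQ N, f x ^ 2 * φ₁ (x.1 + m t)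
        ≤ ∫ x in ΩQ N, (2 * ((f x - c) ^ 2 * ψ (x.1 + m t)) + 2 * c ^ 2 * φ₁ (x.1 + m t)) := by
      refine integral_mono_of_nonneg (ae_of_all _ fun x => mul_nonneg (sq_nonneg _) (hφ₁pos _))
        ((hint.const_mul _).add ((hcomp hφ₁int).const_mul _)) (ae_of_all _ fun x => ?_)
      have h1 : φ₁ (x.1 + m t) ≤ ψ (x.1 + m t) := le_add_of_nonneg_right (abs_nonneg _)
      have h2 := mul_le_mul_of_nonneg_left h1 (sq_nonneg (f x - c))
      have h3 : f x ^ 2 ≤ 2 * (f x - c) ^ 2 + 2 * c ^ 2 := by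
        nlinarith [sq_nonneg (f x - 2 * c)]
      have h4 := mul_le_mul_of_nonneg_right h3 (hφ₁pos (x.1 + m t))
      simp only
      linarith
    rwa [integral_add (hint.const_mul _) ((hcomp hφ₁int).const_mul _), integral_const_mul,
      integral_const_mul, hcompInt hφ₁int] at h
  set k := 4 * I₁ / α ^ 2 with hk
  have hk0 : 0 ≤ k := by positivity
  calc ∫ x in ΩQ N, f x ^ 2 * φ₁ (x.1 + m t)
      ≤ 2 * J + 2 * c ^ 2 * I₁ := hmain
    _ ≤ 2 * (B * G) + 2 * (2 * (A ^ 2 + B * G * L) / α ^ 2) * I₁ := by gcongr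
    _ = 2 * B * G + k * (A ^ 2 + B * L * G) := by rw [hk]; ring
    _ ≤ (2 * B + k * (B * L + 1) + 1) * (A ^ 2 + G) := by
      have h1 : 0 ≤ (2 * B + k * (B * L) + 1) * A ^ 2 := by positivity
      have h2 : 0 ≤ (k + 1) * G := by positivity
      linarith

end ShockMultiD
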